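/- Let n ≥ m ≥ 1 be integers, ν, k reals with ν/2 + k > 0, τ = (t_1,…,t_m) ∈ ℝ^m with t_1 ≥ … ≥ t_m and n/2 > (m−1)/2 − t_m, and ρ > 0. Let Σ be an m×m positive definite real matrix, Θ an n×n positive definite real matrix, μ_0 ∈ ℝ^{n×m}, and let T_Σ (m×m) and T_Θ (n×n) be upper triangular matrices with positive diagonal entries such that Σ = T_Σᵀ T_Σ and Θ = T_Θᵀ T_Θ. Let π be the measure on ℝ^{n×m} with density R ↦ [Γ_m(n/2) Γ((ν+mn)/2 + k + Σ_i t_i)]/[π^{mn/2} Γ_m(n/2, τ) Γ(ν/2+k)] (1 − tr(RᵀR))^{ν/2+k−1} q_τ(RᵀR) on {tr(RᵀR) < 1} and 0 elsewhere. Then the pushforward of π under the map R ↦ C = ρ^{−1/2} T_Θᵀ R T_Σ + μ_0 has density C ↦ [Γ_m(n/2) Γ((ν+mn)/2 + k + Σ_i t_i) ρ^{mn/2 + Σ_i t_i}]/[π^{mn/2} Γ_m(n/2, τ) Γ(ν/2+k) (det Σ)^{n/2} (det Θ)^{m/2}] · (1 − ρ tr(Σ^{−1}(C−μ_0)ᵀ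 Θ^{−1}(C−μ_0)))^{ν/2+k−1} q_τ(T_Σ^{−ᵀ}(C−μ_0)ᵀ Θ^{−1}(C−μ_0) T_Σ^{−1}) on the set where ρ tr(Σ^{−1}(C−μ_0)ᵀ Θ^{−1}(C−μ_0)) < 1, and 0 elsewhere (the matrix multivariate Pearson type II-Riesz distribution). -/

import Mathlib

open MeasureTheory Matrix Real

instance matMeasurableSpace {n m : ℕ} {α : Type*} [MeasurableSpace α] :
    MeasurableSpace (Matrix (Fin n) (Fin m) α) :=
  inferInstanceAs (MeasurableSpace (Fin n → Fin m → α))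

noncomputable instance matMeasureSpace {n m : ℕ} {α : Type*} [MeasureSpace α]
    [SigmaFinite (volume : Measure α)] : MeasureSpace (Matrix (Fin n) (Fin m) α) :=
  inferInstanceAs (MeasureSpace (Fin n → Fin m → α))

/-- Determinant of the leading principal `i × i` submatrix. -/
noncomputable def leadMinor {m : ℕ} (A : Matrix (Fin m) (Fin m) ℝ) (i : ℕ) : ℝ :=
  if h : i ≤ m then (A.submatrix (Fin.castLE h) (Fin.castLE h)).det else 0

/-- Highest weight vector `q_τ(A) = det(A)^{t_m} ∏_{i=1}^{m−1} det(A_i)^{t_i − t_{i+1}}`. -/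
noncomputable def hwVector {m : ℕ} (τ : Fin m → ℝ) (A : Matrix (Fin m) (Fin m) ℝ) : ℝ :=
  ∏ i : Fin m,
    leadMinor A ((i : ℕ) + 1) ^ (τ i - if h : (i : ℕ) + 1 < m then τ ⟨(i : ℕ) + 1, h⟩ else 0)

/-- Real multivariate gamma function `Γ_m(a)`. -/
noncomputable def mvGamma (m : ℕ) (a : ℝ) : ℝ :=
  π ^ ((m : ℝ) * ((m : ℝ) - 1) / 4) * ∏ i : Fin m, Gamma (a - (i : ℝ) / 2)

/-- Generalized gamma function of weight `τ`, `Γ_m(a, τ)`. -/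
noncomputable def mvGammaW {m : ℕ} (a : ℝ) (τ : Fin m → ℝ) : ℝ :=
  π ^ ((m : ℝ) * ((m : ℝ) - 1) / 4) * ∏ i : Fin m, Gamma (a + τ i - (i : ℝ) / 2)

/-- The determinant of `R ↦ A * R * B` on `n × m` matrices. -/
lemma det_of_apply_eq_mul_mul {n m : ℕ} (A : Matrix (Fin n) (Fin n) ℝ)
    (B : Matrix (Fin m) (Fin m) ℝ)
    (L : Matrix (Fin n) (Fin m) ℝ →ₗ[ℝ] Matrix (Fin n) (Fin m) ℝ)
    (hL : ∀ R, L R = A * R * B) :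
    LinearMap.det L = A.det ^ m * B.det ^ n := by
  let e : Matrix (Fin n) (Fin m) ℝ ≃ₗ[ℝ] (Fin m × Fin n → ℝ) :=
    LinearEquiv.ofBijective
      { toFun := vec, map_add' := vec_add, map_smul' := vec_smul } vec_bijective
  have h : (e : Matrix (Fin n) (Fin m) ℝ →ₗ[ℝ] (Fin m × Fin n → ℝ)) ∘ₗ L ∘ₗ
      (e.symm : (Fin m × Fin n → ℝ) →ₗ[ℝ] Matrix (Fin n) (Fin m) ℝ) =
      toLin' (kroneckerMap (· * ·) Bᵀ A) := by
    refine LinearMap.ext fun v => ?_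
    obtain ⟨X, rfl⟩ := e.surjective v
    simp only [LinearMap.comp_apply, LinearEquiv.coe_coe, LinearEquiv.symm_apply_apply, hL,
      toLin'_apply]
    have h := kronecker_mulVec_vec A X Bᵀ
    rw [transpose_transpose] at h
    exact h.symm
  rw [← LinearMap.det_conj L e, h, LinearMap.det_toLin', det_kronecker, det_transpose]
  simp [mul_comm]

lemma map_mul_mul_volume {n m : ℕ} {A : Matrix (Fin n) (Fin n) ℝ}
    {B : Matrix (Fin m) (Fin m) ℝ} (hA : A.det ≠ 0) (hB : B.det ≠ 0) :
    Measure.map (fun R : Matrix (Fin n) (Fin m) ℝ => A * R * B) volume =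
      ENNReal.ofReal |(A.det ^ m * B.det ^ n)⁻¹| • volume := by
  let L : Matrix (Fin n) (Fin m) ℝ →ₗ[ℝ] Matrix (Fin n) (Fin m) ℝ :=
    { toFun := fun R => A * R * B
      map_add' := fun X Y => by simp [Matrix.mul_add, Matrix.add_mul]
      map_smul' := fun c X => by simp }
  have hdet := det_of_apply_eq_mul_mul A B L fun _ => rfl
  have hne : LinearMap.det L ≠ 0 := by
    rw [hdet]; positivity
  rw [← hdet]
  exact Measure.map_linearMap_addHaar_eq_smul_addHaar (E := Fin n → Fin m → ℝ) volume (f := L) hne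

lemma map_add_const_volume {n m : ℕ} (M : Matrix (Fin n) (Fin m) ℝ) :
    Measure.map (fun R : Matrix (Fin n) (Fin m) ℝ => R + M) volume = volume :=
  map_add_right_eq_self (G := Fin n → Fin m → ℝ) volume M

lemma measurable_mul_mul {n m : ℕ} (A : Matrix (Fin n) (Fin n) ℝ)
    (B : Matrix (Fin m) (Fin m) ℝ) :
    Measurable (fun R : Matrix (Fin n) (Fin m) ℝ => A * R * B) := by
  have h : BorelSpace (Matrix (Fin n) (Fin m) ℝ) :=
    inferInstanceAs (BorelSpace (Fin n → Fin m → ℝ))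
  exact (by fun_prop : Continuous fun R : Matrix (Fin n) (Fin m) ℝ => A * R * B).measurable

lemma measurable_add_const_matrix {n m : ℕ} (M : Matrix (Fin n) (Fin m) ℝ) :
    Measurable (fun R : Matrix (Fin n) (Fin m) ℝ => R + M) := by
  have h : BorelSpace (Matrix (Fin n) (Fin m) ℝ) :=
    inferInstanceAs (BorelSpace (Fin n → Fin m → ℝ))
  exact (by fun_prop : Continuous fun R : Matrix (Fin n) (Fin m) ℝ => R + M).measurable

/-- The invertible affine map `R ↦ A * R * B + M` as a measurable equivalence. -/
noncomputable def affineMeasurableEquiv {n m : ℕ} {A : Matrix (Fin n) (Fin n) ℝ}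
    {B : Matrix (Fin m) (Fin m) ℝ} (hA : A.det ≠ 0) (hB : B.det ≠ 0)
    (M : Matrix (Fin n) (Fin m) ℝ) :
    Matrix (Fin n) (Fin m) ℝ ≃ᵐ Matrix (Fin n) (Fin m) ℝ where
  toFun R := A * R * B + M
  invFun C := A⁻¹ * (C + -M) * B⁻¹
  left_inv R := by
    have hA' := hA.isUnit
    have hB' := hB.isUnit
    simp [Matrix.mul_assoc, Matrix.mul_nonsing_inv _ hB', Matrix.nonsing_inv_mul_cancel_left _ _ hA']
  right_inv C := by
    have hA' := hA.isUnit
    have hB' := hB.isUnit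
    simp [Matrix.mul_assoc, Matrix.nonsing_inv_mul _ hB', Matrix.mul_nonsing_inv_cancel_left _ _ hA']
  measurable_toFun := (measurable_add_const_matrix M).comp (measurable_mul_mul A B)
  measurable_invFun := (measurable_mul_mul A⁻¹ B⁻¹).comp (measurable_add_const_matrix (-M))

lemma map_withDensity_of_map_eq_smul {α β : Type*} [MeasurableSpace α] [MeasurableSpace β]
    {μ : Measure α} {κ : Measure β} (e : α ≃ᵐ β) {c : ENNReal} (hc : c ≠ ⊤)
    (he : μ.map e = c • κ) {f : α → ENNReal} {g : β → ENNReal}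
    (hfg : ∀ x, g (e x) = c * f x) :
    (μ.withDensity f).map e = κ.withDensity g := by
  have hg : g = c • (f ∘ e.symm) := by
    ext y
    simpa using hfg (e.symm y)
  rw [hg, withDensity_smul' _ _ hc, ← withDensity_smul_measure, ← he]
  ext s hs
  rw [Measure.map_apply e.measurable hs, withDensity_apply _ (e.measurable hs),
    withDensity_apply _ hs, e.restrict_map, lintegral_map_equiv]
  simp

lemma leadMinor_smul {m : ℕ} (c : ℝ) (A : Matrix (Fin m) (Fin m) ℝ) (i : ℕ) :
    leadMinor (c • A) i = c ^ i * leadMinor A i := by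
  unfold leadMinor
  split_ifs with h
  · simp [submatrix_smul]
  · simp

lemma leadMinor_transpose_mul_self_nonneg {n m : ℕ} (Y : Matrix (Fin n) (Fin m) ℝ) (i : ℕ) :
    0 ≤ leadMinor (Yᵀ * Y) i := by
  unfold leadMinor
  split_ifs with h
  · have := (posSemidef_conjTranspose_mul_self Y).submatrix (Fin.castLE h)
    simpa using this.det_nonneg
  · exact le_rfl

lemma sum_succ_mul_sub_next {m : ℕ} (τ : Fin m → ℝ) :
    ∑ i : Fin m, ((i : ℕ) + 1 : ℝ) *
      (τ i - if h : (i : ℕ) + 1 < m then τ ⟨(i : ℕ) + 1, h⟩ else 0) = ∑ i, τ i := by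
  let u : ℕ → ℝ := fun j => if h : j < m then τ ⟨j, h⟩ else 0
  have hu : ∀ i : Fin m, τ i = u i := fun i => by simp [u]
  have key : ∀ N, ∑ i ∈ Finset.range N, ((i : ℝ) + 1) * (u i - u (i + 1)) =
      ∑ i ∈ Finset.range N, u i - N * u N := by
    intro N
    induction N with
    | zero => simp
    | succ N ih =>
      rw [Finset.sum_range_succ, ih, Finset.sum_range_succ]
      push_cast
      ring
  have hm : u m = 0 := by simp [u]
  have h := key m
  rw [hm, mul_zero, sub_zero, ← Fin.sum_univ_eq_sum_range u,
    ← Fin.sum_univ_eq_sum_range (fun i => ((i : ℝ) + 1) * (u i - u (i + 1)))] at h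
  simp_rw [← hu] at h
  exact h

/-- The highest weight vector is homogeneous of degree `∑ τ i` on Gram matrices. -/
lemma hwVector_smul_transpose_mul_self {n m : ℕ} (τ : Fin m → ℝ) {c : ℝ} (hc : 0 < c)
    (Y : Matrix (Fin n) (Fin m) ℝ) :
    hwVector τ (c • (Yᵀ * Y)) = c ^ (∑ i, τ i) * hwVector τ (Yᵀ * Y) := by
  unfold hwVector
  rw [← sum_succ_mul_sub_next τ, Real.rpow_sum_of_pos hc, ← Finset.prod_mul_distrib]
  refine Finset.prod_congr rfl fun i _ => ?_
  rw [leadMinor_smul, Real.mul_rpow (by positivity) (leadMinor_transpose_mul_self_nonneg Y _),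
    ← Real.rpow_natCast, ← Real.rpow_mul hc.le]
  push_cast
  rfl

/-- Corollary 3.1 (β = 1): if `R` has the standardized matrix multivariate Pearson type
II-Riesz distribution, then `C = ρ^{−1/2} T_Θᵀ R T_Σ + μ₀` has the (general) matrix
multivariate Pearson type II-Riesz distribution, stated as an identity of the pushforward
measure. -/
theorem pearsonII_riesz_affine_transform {n m : ℕ} (hm : 1 ≤ m) (hnm : m ≤ n)
    (ν k : ℝ) (hνk : 0 < ν / 2 + k) (τ : Fin m → ℝ) (hτ : Antitone τ)
    (hn : ((m : ℝ) - 1) / 2 - τ ⟨m - 1, by omega⟩ < (n : ℝ) / 2)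
    (ρ : ℝ) (hρ : 0 < ρ)
    (Sig : Matrix (Fin m) (Fin m) ℝ) (hSigPD : Sig.PosDef)
    (Th : Matrix (Fin n) (Fin n) ℝ) (hThPD : Th.PosDef)
    (μ₀ : Matrix (Fin n) (Fin m) ℝ)
    (TS : Matrix (Fin m) (Fin m) ℝ) (hTS : TS.BlockTriangular id) (hTSd : ∀ i, 0 < TS i i)
    (hSig : Sig = TSᵀ * TS)
    (TT : Matrix (Fin n) (Fin n) ℝ) (hTT : TT.BlockTriangular id) (hTTd : ∀ i, 0 < TT i i)
    (hTh : Th = TTᵀ * TT) :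
    Measure.map
      (fun R : Matrix (Fin n) (Fin m) ℝ => (ρ ^ (-(1 / 2) : ℝ)) • (TTᵀ * R * TS) + μ₀)
      (volume.withDensity fun R : Matrix (Fin n) (Fin m) ℝ =>
        ENNReal.ofReal
          (if (Rᵀ * R).trace < 1 then
            mvGamma m ((n : ℝ) / 2) * Gamma ((ν + m * n) / 2 + k + ∑ i, τ i) /
                (π ^ ((m : ℝ) * n / 2) * mvGammaW ((n : ℝ) / 2) τ * Gamma (ν / 2 + k)) *
              (1 - (Rᵀ * R).trace) ^ (ν / 2 + k - 1) * hwVector τ (Rᵀ * R)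
          else 0)) =
    volume.withDensity fun C : Matrix (Fin n) (Fin m) ℝ =>
      ENNReal.ofReal
        (if ρ * (Sig⁻¹ * (C - μ₀)ᵀ * Th⁻¹ * (C - μ₀)).trace < 1 then
          mvGamma m ((n : ℝ) / 2) * Gamma ((ν + m * n) / 2 + k + ∑ i, τ i) *
              ρ ^ ((m : ℝ) * n / 2 + ∑ i, τ i) /
              (π ^ ((m : ℝ) * n / 2) * mvGammaW ((n : ℝ) / 2) τ * Gamma (ν / 2 + k) *
                Sig.det ^ ((n : ℝ) / 2) * Th.det ^ ((m : ℝ) / 2)) *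
            (1 - ρ * (Sig⁻¹ * (C - μ₀)ᵀ * Th⁻¹ * (C - μ₀)).trace) ^ (ν / 2 + k - 1) *
            hwVector τ ((TS⁻¹)ᵀ * (C - μ₀)ᵀ * Th⁻¹ * (C - μ₀) * TS⁻¹)
        else 0) := by
  have hTS0 : 0 < TS.det := by
    rw [det_of_isUpperTriangular hTS]
    exact Finset.prod_pos fun i _ => hTSd i
  have hTT0 : 0 < TT.det := by
    rw [det_of_isUpperTriangular hTT]
    exact Finset.prod_pos fun i _ => hTTd i
  set r : ℝ := ρ ^ (-(1 / 2) : ℝ) with hr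
  have hr0 : 0 < r := Real.rpow_pos_of_pos hρ _
  have hρr : ρ * r ^ 2 = 1 := by
    rw [hr, ← Real.rpow_natCast, ← Real.rpow_mul hρ.le]
    norm_num
    rw [Real.rpow_neg_one, mul_inv_cancel₀ hρ.ne']
  have hA : (r • TTᵀ).det ≠ 0 := by
    rw [det_smul, det_transpose]
    positivity
  have hmap : Measure.map (affineMeasurableEquiv hA hTS0.ne' μ₀) volume =
      ENNReal.ofReal |((r • TTᵀ).det ^ m * TS.det ^ n)⁻¹| • volume := by
    calc _ = Measure.map (fun R => R + μ₀)
          (Measure.map (fun R : Matrix (Fin n) (Fin m) ℝ => r • TTᵀ * R * TS) volume) :=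
          (Measure.map_map (measurable_add_const_matrix μ₀) (measurable_mul_mul _ _)).symm
      _ = _ := by
        rw [map_mul_mul_volume hA hTS0.ne', Measure.map_smul, map_add_const_volume]
  have hfun : (fun R : Matrix (Fin n) (Fin m) ℝ => r • (TTᵀ * R * TS) + μ₀) =
      affineMeasurableEquiv hA hTS0.ne' μ₀ := by
    ext1 R
    simp [affineMeasurableEquiv]
  rw [hfun]
  refine map_withDensity_of_map_eq_smul _ ENNReal.ofReal_ne_top hmap fun R => ?_
  rw [← hfun, ← ENNReal.ofReal_mul (abs_nonneg _)]
  congr 1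
  have hTSu : IsUnit TS.det := hTS0.ne'.isUnit
  have hTTu : IsUnit TT.det := hTT0.ne'.isUnit
  have hTTu' : IsUnit TTᵀ.det := by rwa [det_transpose]
  have hTSu' : IsUnit TSᵀ.det := by rwa [det_transpose]
  have hmid : (r • (TTᵀ * R * TS))ᵀ * Th⁻¹ * (r • (TTᵀ * R * TS)) =
      r ^ 2 • (TSᵀ * (Rᵀ * R) * TS) := by
    rw [hTh, Matrix.mul_inv_rev]
    simp only [transpose_smul, transpose_mul, transpose_transpose, Matrix.smul_mul,
      Matrix.mul_smul, smul_smul, Matrix.mul_assoc, mul_nonsing_inv_cancel_left _ _ hTTu,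
      nonsing_inv_mul_cancel_left _ _ hTTu', pow_two]
  have htr : ρ * (Sig⁻¹ * (r • (TTᵀ * R * TS))ᵀ * Th⁻¹ * (r • (TTᵀ * R * TS))).trace =
      (Rᵀ * R).trace := by
    rw [Matrix.mul_assoc Sig⁻¹, Matrix.mul_assoc Sig⁻¹, hmid, hSig, Matrix.mul_inv_rev,
      Matrix.mul_smul, trace_smul, smul_eq_mul, ← mul_assoc, hρr, one_mul]
    rw [Matrix.mul_assoc TS⁻¹, Matrix.mul_assoc TSᵀ, nonsing_inv_mul_cancel_left _ _ hTSu',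
      trace_mul_comm, Matrix.mul_assoc, mul_nonsing_inv _ hTSu, Matrix.mul_one]
  have hq : (TS⁻¹)ᵀ * (r • (TTᵀ * R * TS))ᵀ * Th⁻¹ * (r • (TTᵀ * R * TS)) * TS⁻¹ =
      r ^ 2 • (Rᵀ * R) := by
    rw [Matrix.mul_assoc (TS⁻¹)ᵀ, Matrix.mul_assoc (TS⁻¹)ᵀ, hmid, transpose_nonsing_inv]
    simp only [Matrix.smul_mul, Matrix.mul_smul, Matrix.mul_assoc,
      nonsing_inv_mul_cancel_left _ _ hTSu', mul_nonsing_inv _ hTSu, Matrix.mul_one]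
  simp only [add_sub_cancel_right, htr, hq]
  split_ifs with h1
  · have hr2 : r ^ 2 = ρ⁻¹ := by
      rw [eq_comm, inv_eq_iff_eq_inv]
      exact eq_inv_of_mul_eq_one_left hρr
    have hTh2 : Th.det ^ ((m : ℝ) / 2) = TT.det ^ m := by
      rw [hTh, det_mul, det_transpose, ← pow_two, ← Real.rpow_natCast, ← Real.rpow_natCast,
        ← Real.rpow_mul hTT0.le]
      congr 1
      push_cast
      ring
    have hSig2 : Sig.det ^ ((n : ℝ) / 2) = TS.det ^ n := by
      rw [hSig, det_mul, det_transpose, ← pow_two, ← Real.rpow_natCast, ← Real.rpow_natCast,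
        ← Real.rpow_mul hTS0.le]
      congr 1
      push_cast
      ring
    have hρn : ρ ^ ((m : ℝ) * n / 2) = ((r ^ n) ^ m)⁻¹ := by
      rw [hr, ← Real.rpow_natCast, ← Real.rpow_natCast, ← Real.rpow_mul hρ.le,
        ← Real.rpow_mul hρ.le, ← Real.rpow_neg hρ.le]
      congr 1
      ring
    rw [hwVector_smul_transpose_mul_self τ (by positivity),
      abs_of_pos (by rw [det_smul, det_transpose]; positivity), det_smul, det_transpose, hTh2, hSig2,
      Real.rpow_add hρ, hρn, hr2, Real.inv_rpow hρ.le, Fintype.card_fin, mul_pow]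
    have : ρ ^ (∑ i, τ i) ≠ 0 := (Real.rpow_pos_of_pos hρ _).ne'
    have hT1 := hTT0.ne'
    have hT2 := hTS0.ne'
    have hr1 := hr0.ne'
    generalize ρ ^ (∑ i, τ i) = P at *
    generalize (1 - (Rᵀ * R).trace) ^ (ν / 2 + k - 1) = Q at *
    generalize hwVector τ (Rᵀ * R) = W at *
    generalize mvGamma m ((n : ℝ) / 2) * Gamma ((ν + m * n) / 2 + k + ∑ i, τ i) = G at *
    generalize π ^ ((m : ℝ) * n / 2) * mvGammaW ((n : ℝ) / 2) τ * Gamma (ν / 2 + k) = H at *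
    simp only [div_eq_mul_inv, mul_inv]
    field_simp
  · simp
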